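/- Let R be a commutative ring, k ≥ 1, t_1, …, t_k ∈ R, let C(X) = X^k - t_1·X^{k-1} - … - t_k, let A be the companion matrix of C over R, and let D = C′(A) be the result of evaluating the derivative of C at A. Then for all natural numbers n and all row indices i with 0 ≤ i ≤ k-1, the entry of D·A^n in row i and the last column (column k-1) equals tr(A^{n+i}). In particular, the right-hand column of the orbit of D under A consists of the Generalized Lucas sequence tr(A^m). -/

import Mathlib

/-- The companion matrix of the core polynomial
`C(X) = X^k - t_1 X^{k-1} - ... - t_k`, where `t i` is `t_{i+1}` (0-indexed):
entries `(i, i+1)` equal `1`, the last row is `(t_k, t_{k-1}, ..., t_1)`,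
and all other entries are `0`. -/
def coreCompanion {R : Type*} [CommRing R] {k : ℕ} (t : Fin k → R) :
    Matrix (Fin k) (Fin k) R :=
  Matrix.of fun i j =>
    if (i : ℕ) + 1 = (j : ℕ) then 1
    else if (i : ℕ) = k - 1 then t ⟨k - 1 - (j : ℕ), by have := j.isLt; omega⟩
    else 0

/-- The core polynomial `C(X) = X^k - t_1 X^{k-1} - ... - t_k`. -/
noncomputable def corePoly {R : Type*} [CommRing R] {k : ℕ} (t : Fin k → R) :
    Polynomial R :=
  Polynomial.X ^ k - ∑ i : Fin k, Polynomial.C (t i) * Polynomial.X ^ (k - 1 - (i : ℕ))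

open Polynomial in
/-- The Horner polynomials `X ^ s - t 0 * X ^ (s - 1) - ... - t (s - 1)` of a sequence `t`. -/
noncomputable def hornerPoly {R : Type*} [CommRing R] (t : ℕ → R) : ℕ → R[X]
  | 0 => 1
  | s + 1 => X * hornerPoly t s - C (t s)

section Horner

open Polynomial

variable {R : Type*} [CommRing R]

theorem hornerPoly_eq (t : ℕ → R) (n : ℕ) :
    hornerPoly t n = X ^ n - ∑ l ∈ Finset.range n, C (t l) * X ^ (n - 1 - l) := by
  induction n with
  | zero => simp [hornerPoly]
  | succ n ih =>
    have h : ∑ l ∈ Finset.range n, C (t l) * X ^ (n - l) =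
        X * ∑ l ∈ Finset.range n, C (t l) * X ^ (n - 1 - l) := by
      rw [Finset.mul_sum]
      refine Finset.sum_congr rfl fun l hl => ?_
      have hl : n - l = n - 1 - l + 1 := by have := Finset.mem_range.mp hl; omega
      rw [hl]
      ring
    rw [hornerPoly, ih, Finset.sum_range_succ, Nat.add_sub_cancel, h, Nat.sub_self]
    ring

theorem derivative_hornerPoly (t : ℕ → R) (n : ℕ) :
    derivative (hornerPoly t n) =
      ∑ s ∈ Finset.range n, X ^ (n - 1 - s) * hornerPoly t s := by
  induction n with
  | zero => simp [hornerPoly]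
  | succ n ih =>
    have h : ∑ s ∈ Finset.range n, X ^ (n - s) * hornerPoly t s =
        X * ∑ s ∈ Finset.range n, X ^ (n - 1 - s) * hornerPoly t s := by
      rw [Finset.mul_sum]
      refine Finset.sum_congr rfl fun s hs => ?_
      have hs : n - s = n - 1 - s + 1 := by have := Finset.mem_range.mp hs; omega
      rw [hs]
      ring
    rw [Finset.sum_range_succ, Nat.add_sub_cancel, h, ← ih, hornerPoly]
    simp [add_comm]

theorem corePoly_eq_hornerPoly {k : ℕ} (t : Fin k → R) :
    corePoly t = hornerPoly (fun l => if h : l < k then t ⟨l, h⟩ else 0) k := by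
  rw [hornerPoly_eq, corePoly, Finset.sum_range]
  simp

end Horner

section CoreCompanion

variable {R : Type*} [CommRing R] {k : ℕ}

theorem coreCompanion_mul_apply (t : Fin k → R) (M : Matrix (Fin k) (Fin k) R)
    (i : ℕ) (hi : i + 1 < k) (j : Fin k) :
    (coreCompanion t * M) ⟨i, by omega⟩ j = M ⟨i + 1, hi⟩ j := by
  rw [Matrix.mul_apply, Finset.sum_eq_single ⟨i + 1, hi⟩]
  · simp [coreCompanion]
  · intro b _ hb
    have h₁ : ¬ i + 1 = (b : ℕ) := fun h => hb (Fin.ext h.symm)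
    have h₂ : ¬ i = k - 1 := by omega
    simp [coreCompanion, h₁, h₂]
  · simp

theorem coreCompanion_pow_mul_apply_zero (t : Fin k → R) (i : Fin k) :
    ∀ (M : Matrix (Fin k) (Fin k) R) (j : Fin k),
      (coreCompanion t ^ (i : ℕ) * M) ⟨0, i.pos⟩ j = M i j := by
  obtain ⟨i, hi⟩ := i
  induction i with
  | zero => simp
  | succ i ih =>
    intro M j
    rw [pow_succ, mul_assoc]
    exact (ih (by omega) _ j).trans (coreCompanion_mul_apply t M i hi j)

theorem aeval_coreCompanion_hornerPoly_apply_last (t : Fin k → R) (s : ℕ) (hs : s < k) :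
    ∀ i : Fin k,
      Polynomial.aeval (coreCompanion t)
          (hornerPoly (fun l => if h : l < k then t ⟨l, h⟩ else 0) s) i ⟨k - 1, by omega⟩ =
        (1 : Matrix (Fin k) (Fin k) R) i ⟨k - 1 - s, by omega⟩ := by
  induction s with
  | zero =>
    intro i
    rw [hornerPoly, map_one]
    rfl
  | succ s ih =>
    intro i
    have hs' : s < k := by omega
    have h : k - 1 - (k - 1 - s) = s := by omega
    rw [hornerPoly, map_sub, map_mul, Polynomial.aeval_X, Polynomial.aeval_C, Matrix.sub_apply,
      Matrix.mul_apply]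
    simp only [ih hs', ← Matrix.mul_apply, mul_one]
    simp only [Matrix.algebraMap_matrix_apply, coreCompanion, Matrix.of_apply, Matrix.one_apply,
      Fin.ext_iff, h, hs', dite_true, Algebra.algebraMap_self, RingHom.id_apply]
    split_ifs <;> first | omega | simp

/-- The trace form of `R[X] / (C)`, in terms of the dual basis given by the Horner polynomials. -/
theorem trace_coreCompanion_pow (t : Fin k → R) (hk : 0 < k) (m : ℕ) :
    (coreCompanion t ^ m).trace =
      (Polynomial.aeval (coreCompanion t) (Polynomial.derivative (corePoly t)) *
        coreCompanion t ^ m) ⟨0, hk⟩ ⟨k - 1, by omega⟩ := by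
  set A := coreCompanion t with hA
  set p := hornerPoly (fun l => if h : l < k then t ⟨l, h⟩ else 0) with hp
  have hdiag (s : Fin k) :
      (A ^ (k - 1 - (s : ℕ)) * Polynomial.aeval A (p s) * A ^ m) ⟨0, hk⟩ ⟨k - 1, by omega⟩ =
        (A ^ m) (Fin.rev s) (Fin.rev s) := by
    have hcomm : Polynomial.aeval A (p s) * A ^ m = A ^ m * Polynomial.aeval A (p s) := by
      simpa using congrArg (Polynomial.aeval A) (mul_comm (p s) (Polynomial.X ^ m))
    have hrev : (Fin.rev s : ℕ) = k - 1 - s := by simp [Fin.val_rev]; omega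
    have hrev' : (⟨k - 1 - s, by omega⟩ : Fin k) = Fin.rev s := Fin.ext hrev.symm
    rw [mul_assoc, hcomm, ← hrev]
    refine (coreCompanion_pow_mul_apply_zero t (Fin.rev s) _ _).trans ?_
    rw [Matrix.mul_apply]
    simp only [hA, hp, aeval_coreCompanion_hornerPoly_apply_last t s s.isLt, ← Matrix.mul_apply,
      mul_one, hrev']
  rw [corePoly_eq_hornerPoly, derivative_hornerPoly, map_sum, Finset.sum_mul, Matrix.sum_apply,
    Finset.sum_range, Matrix.trace, ← Equiv.sum_comp Fin.revPerm]
  refine Finset.sum_congr rfl fun s _ => ?_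
  rw [map_mul, map_pow, Polynomial.aeval_X]
  exact (hdiag s).symm

end CoreCompanion

theorem different_orbit_last_column_is_lucas
    {R : Type*} [CommRing R] (k : ℕ) (hk : 1 ≤ k) (t : Fin k → R) :
    ∀ (n : ℕ) (i : Fin k),
      (Polynomial.aeval (coreCompanion t) (Polynomial.derivative (corePoly t)) *
          coreCompanion t ^ n) i ⟨k - 1, by omega⟩ =
        (coreCompanion t ^ (n + (i : ℕ))).trace := by
  intro n i
  have hcomm : coreCompanion t ^ (i : ℕ) *
      Polynomial.aeval (coreCompanion t) (Polynomial.derivative (corePoly t)) =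
      Polynomial.aeval (coreCompanion t) (Polynomial.derivative (corePoly t)) *
        coreCompanion t ^ (i : ℕ) := by
    simpa using congrArg (Polynomial.aeval (coreCompanion t))
      (mul_comm (Polynomial.X ^ (i : ℕ)) (Polynomial.derivative (corePoly t)))
  refine (coreCompanion_pow_mul_apply_zero t i _ _).symm.trans ?_
  rw [trace_coreCompanion_pow t hk, ← mul_assoc, hcomm, mul_assoc, ← pow_add, add_comm]
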